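/- arXiv:2508.10282 — 3 statements merged into one kernel-verified Lean document; each statement's English description precedes it below -/
import Mathlib

section
/- Let w* be a prior probability measure on Θ attaining C = sup_w I_w(θ;Y|X^n), let θ̃ ∈ Θ, and for t ∈ [0,1] let w_t = (1−t)w* + tδ_{θ̃} be the mixture of w* with the point mass at θ̃. Then the function f(t) = I_{w_t}(θ;Y|X^n) has right derivative at t = 0 equal to f'(0) = R(p̂*,θ̃) − C, where p̂* is the conditional mixture predictor associated with w* and R(p̂*,θ̃) = Σ_{x^n} p_{θ̃}(x^n) Σ_y p_{θ̃}(y) log(p_{θ̃}(y)/p̂*(y|x^n)). -/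
open MeasureTheory Real Filter

/-- `q` is a probability mass function on the finite type `B`. -/
def IsPMF {B : Type*} [Fintype B] (q : B → ℝ) : Prop :=
  (∀ y, 0 ≤ q y) ∧ ∑ y, q y = 1

/-- Probability of a tuple of `n` i.i.d. batches: `p_θ(x^n) = ∏ i, p_θ(x_i)`. -/
def prodP {Θ B : Type*} (p : Θ → B → ℝ) (n : ℕ) (θ : Θ) (x : Fin n → B) : ℝ :=
  ∏ i, p θ (x i)

/-- The batch regret `R(p̂,θ) = Σ_{x^n} p_θ(x^n) Σ_y p_θ(y) log (p_θ(y) / p̂(y|x^n))`. -/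
noncomputable def batchRegret {Θ B : Type*} [Fintype B] (p : Θ → B → ℝ) (n : ℕ)
    (phat : (Fin n → B) → B → ℝ) (θ : Θ) : ℝ :=
  ∑ x : Fin n → B, prodP p n θ x * ∑ y : B, p θ y * Real.log (p θ y / phat x y)

/-- The conditional mixture predictor
`p̂_w(y|x^n) = ∫ p_θ(y) w(dθ|x^n) = (∫ p_θ(x^n) p_θ(y) w(dθ)) / (∫ p_θ(x^n) w(dθ))`. -/
noncomputable def mixPred {Θ B : Type*} [MeasurableSpace Θ] [Fintype B]
    (p : Θ → B → ℝ) (n : ℕ) (w : Measure Θ) (x : Fin n → B) (y : B) : ℝ :=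
  (∫ θ, prodP p n θ x * p θ y ∂w) / (∫ θ, prodP p n θ x ∂w)

/-- The conditional mutual information
`I_w(θ;Y|X^n) = E[log (p_θ(Y) / p_w(Y|X^n))]`, the expectation being over the joint law
`w(dθ) p_θ(x^n) p_θ(y)`. -/
noncomputable def condMI {Θ B : Type*} [MeasurableSpace Θ] [Fintype B]
    (p : Θ → B → ℝ) (n : ℕ) (w : Measure Θ) : ℝ :=
  ∫ θ, (∑ x : Fin n → B, prodP p n θ x *
    ∑ y : B, p θ y * Real.log (p θ y / mixPred p n w x y)) ∂w

/-- The mixture prior `w_t = (1-t)·w + t·δ_θ̃`. -/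
noncomputable def mixPrior {Θ : Type*} [MeasurableSpace Θ]
    (w : Measure Θ) (θt : Θ) (t : ℝ) : Measure Θ :=
  ENNReal.ofReal (1 - t) • w + ENNReal.ofReal t • Measure.dirac θt


namespace CMRD

variable {Θ B : Type*} [MeasurableSpace Θ] [Fintype B]

/-- The entropy-type part `Σ_x P(x) Σ_y p(y) log p(y)`. -/
noncomputable def hh (p : Θ → B → ℝ) (n : ℕ) (θ : Θ) : ℝ :=
  ∑ x : Fin n → B, ∑ y : B, prodP p n θ x * (p θ y * Real.log (p θ y))

lemma p_le_one {p : Θ → B → ℝ} (hp : ∀ θ, IsPMF (p θ)) (θ : Θ) (y : B) : p θ y ≤ 1 := by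
  rw [← (hp θ).2]
  exact Finset.single_le_sum (fun i _ => (hp θ).1 i) (Finset.mem_univ y)

lemma P_nonneg {p : Θ → B → ℝ} (hp : ∀ θ, IsPMF (p θ)) (n : ℕ) (θ : Θ) (x : Fin n → B) :
    0 ≤ prodP p n θ x := Finset.prod_nonneg fun i _ => (hp θ).1 _

lemma P_le_one {p : Θ → B → ℝ} (hp : ∀ θ, IsPMF (p θ)) (n : ℕ) (θ : Θ) (x : Fin n → B) :
    prodP p n θ x ≤ 1 := Finset.prod_le_one (fun i _ => (hp θ).1 _) (fun i _ => p_le_one hp θ _)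

lemma P_meas {p : Θ → B → ℝ} (hmeas : ∀ z, Measurable fun θ => p θ z) (n : ℕ) (x : Fin n → B) :
    Measurable fun θ => prodP p n θ x := by
  unfold prodP
  exact Finset.measurable_fun_prod _ fun i _ => hmeas _

lemma plogp_bound {u : ℝ} (h0 : 0 ≤ u) (h1 : u ≤ 1) : |u * Real.log u| ≤ 1 := by
  rcases h0.eq_or_lt with h | h
  · simp [← h]
  · rw [mul_comm]; exact (Real.abs_log_mul_self_lt u h h1).le

lemma int_bdd {w : Measure Θ} [IsFiniteMeasure w] {f : Θ → ℝ} (hf : Measurable f)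
    (hb : ∀ θ, |f θ| ≤ 1) : Integrable f w :=
  Integrable.of_bound hf.aestronglyMeasurable 1 (ae_of_all _ hb)

lemma int_P {p : Θ → B → ℝ} (hp : ∀ θ, IsPMF (p θ)) (hmeas : ∀ z, Measurable fun θ => p θ z)
    (n : ℕ) (w : Measure Θ) [IsFiniteMeasure w] (x : Fin n → B) :
    Integrable (fun θ => prodP p n θ x) w :=
  int_bdd (P_meas hmeas n x) fun θ => by
    rw [abs_of_nonneg (P_nonneg hp n θ x)]; exact P_le_one hp n θ x

lemma int_Pp {p : Θ → B → ℝ} (hp : ∀ θ, IsPMF (p θ)) (hmeas : ∀ z, Measurable fun θ => p θ z)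
    (n : ℕ) (w : Measure Θ) [IsFiniteMeasure w] (x : Fin n → B) (y : B) :
    Integrable (fun θ => prodP p n θ x * p θ y) w :=
  int_bdd ((P_meas hmeas n x).mul (hmeas y)) fun θ => by
    rw [abs_of_nonneg (mul_nonneg (P_nonneg hp n θ x) ((hp θ).1 y))]
    exact mul_le_one₀ (P_le_one hp n θ x) ((hp θ).1 y) (p_le_one hp θ y)

lemma meas_Pplog {p : Θ → B → ℝ} (hmeas : ∀ z, Measurable fun θ => p θ z)
    (n : ℕ) (x : Fin n → B) (y : B) :
    Measurable (fun θ => prodP p n θ x * (p θ y * Real.log (p θ y))) :=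
  (P_meas hmeas n x).mul ((hmeas y).mul (Real.measurable_log.comp (hmeas y)))

lemma int_Pplog {p : Θ → B → ℝ} (hp : ∀ θ, IsPMF (p θ)) (hmeas : ∀ z, Measurable fun θ => p θ z)
    (n : ℕ) (w : Measure Θ) [IsFiniteMeasure w] (x : Fin n → B) (y : B) :
    Integrable (fun θ => prodP p n θ x * (p θ y * Real.log (p θ y))) w :=
  int_bdd (meas_Pplog hmeas n x y) fun θ => by
    rw [abs_mul, abs_of_nonneg (P_nonneg hp n θ x)]
    exact mul_le_one₀ (P_le_one hp n θ x) (abs_nonneg _)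
      (plogp_bound ((hp θ).1 y) (p_le_one hp θ y))

lemma hh_meas {p : Θ → B → ℝ} (hmeas : ∀ z, Measurable fun θ => p θ z) (n : ℕ) :
    Measurable (hh p n) := by
  unfold hh
  exact Finset.measurable_fun_sum _ fun x _ => Finset.measurable_fun_sum _ fun y _ =>
    meas_Pplog hmeas n x y

lemma hh_int {p : Θ → B → ℝ} (hp : ∀ θ, IsPMF (p θ)) (hmeas : ∀ z, Measurable fun θ => p θ z)
    (n : ℕ) (w : Measure Θ) [IsFiniteMeasure w] : Integrable (hh p n) w := by
  unfold hh
  exact integrable_finsetSum _ fun x _ => integrable_finsetSum _ fun y _ =>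
    int_Pplog hp hmeas n w x y

/-- joint mass of `(x, y)` -/
noncomputable def AA (p : Θ → B → ℝ) (n : ℕ) (w : Measure Θ) (x : Fin n → B) (y : B) : ℝ :=
  ∫ θ, prodP p n θ x * p θ y ∂w

/-- mass of `x` -/
noncomputable def BB (p : Θ → B → ℝ) (n : ℕ) (w : Measure Θ) (x : Fin n → B) : ℝ :=
  ∫ θ, prodP p n θ x ∂w

lemma AA_nonneg {p : Θ → B → ℝ} (hp : ∀ θ, IsPMF (p θ)) (n : ℕ) (w : Measure Θ)
    (x : Fin n → B) (y : B) : 0 ≤ AA p n w x y :=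
  integral_nonneg fun θ => mul_nonneg (P_nonneg hp n θ x) ((hp θ).1 y)

lemma BB_nonneg {p : Θ → B → ℝ} (hp : ∀ θ, IsPMF (p θ)) (n : ℕ) (w : Measure Θ)
    (x : Fin n → B) : 0 ≤ BB p n w x :=
  integral_nonneg fun θ => P_nonneg hp n θ x

lemma sum_AA {p : Θ → B → ℝ} (hp : ∀ θ, IsPMF (p θ)) (hmeas : ∀ z, Measurable fun θ => p θ z)
    (n : ℕ) (w : Measure Θ) [IsFiniteMeasure w] (x : Fin n → B) :
    ∑ y, AA p n w x y = BB p n w x := by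
  unfold AA BB
  rw [← integral_finsetSum _ fun y _ => int_Pp hp hmeas n w x y]
  congr 1; ext θ
  rw [← Finset.mul_sum, (hp θ).2, mul_one]

lemma condMI_eq {p : Θ → B → ℝ} (hp : ∀ θ, IsPMF (p θ)) (hmeas : ∀ z, Measurable fun θ => p θ z)
    (n : ℕ) (w : Measure Θ) [IsFiniteMeasure w] :
    condMI p n w = (∫ θ, hh p n θ ∂w)
      - ∑ x, ∑ y, AA p n w x y * Real.log (AA p n w x y)
      + ∑ x, BB p n w x * Real.log (BB p n w x) := by
  have hae : ∀ᵐ θ ∂w, ∀ x : Fin n → B, ∀ y : B, AA p n w x y = 0 → prodP p n θ x * p θ y = 0 := by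
    rw [ae_all_iff]; intro x
    rw [ae_all_iff]; intro y
    by_cases h : AA p n w x y = 0
    · have := (integral_eq_zero_iff_of_nonneg
        (fun θ => mul_nonneg (P_nonneg hp n θ x) ((hp θ).1 y)) (int_Pp hp hmeas n w x y)).1 h
      filter_upwards [this] with θ hθ _
      exact hθ
    · exact ae_of_all _ fun θ h' => absurd h' h
  have hAB : ∀ x y, BB p n w x = 0 → AA p n w x y = 0 := by
    intro x y h
    rw [← sum_AA hp hmeas n w x] at h
    exact (Finset.sum_eq_zero_iff_of_nonneg (fun i _ => AA_nonneg hp n w x i)).1 h y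
      (Finset.mem_univ _)
  have key : ∀ᵐ θ ∂w, (∑ x : Fin n → B, prodP p n θ x *
      ∑ y : B, p θ y * Real.log (p θ y / mixPred p n w x y)) =
      ∑ x : Fin n → B, ∑ y : B, (prodP p n θ x * (p θ y * Real.log (p θ y))
        - prodP p n θ x * p θ y * Real.log (AA p n w x y)
        + prodP p n θ x * p θ y * Real.log (BB p n w x)) := by
    filter_upwards [hae] with θ hθ
    refine Finset.sum_congr rfl fun x _ => ?_
    rw [Finset.mul_sum]
    refine Finset.sum_congr rfl fun y _ => ?_
    change _ * (_ * Real.log (_ / (AA p n w x y / BB p n w x))) = _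
    by_cases h0 : prodP p n θ x * p θ y = 0
    · rw [← mul_assoc, ← mul_assoc, h0]; simp
    · have hA : AA p n w x y ≠ 0 := fun h => h0 (hθ x y h)
      have hB : BB p n w x ≠ 0 := fun h => hA (hAB x y h)
      rw [Real.log_div (right_ne_zero_of_mul h0) (div_ne_zero hA hB), Real.log_div hA hB]
      ring
  unfold condMI
  rw [integral_congr_ae key]
  have i1 := fun x y => int_Pplog hp hmeas n w x y
  have i2 := fun x y => (int_Pp hp hmeas n w x y).mul_const (Real.log (AA p n w x y))
  have i3 := fun x y => (int_Pp hp hmeas n w x y).mul_const (Real.log (BB p n w x))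
  have i4 : ∀ x y, Integrable (fun θ => prodP p n θ x * (p θ y * Real.log (p θ y))
        - prodP p n θ x * p θ y * Real.log (AA p n w x y)
        + prodP p n θ x * p θ y * Real.log (BB p n w x)) w :=
    fun x y => ((i1 x y).sub (i2 x y)).add (i3 x y)
  rw [integral_finsetSum _ fun x _ => integrable_finsetSum _ fun y _ => i4 x y]
  have : ∀ x, (∫ θ, ∑ y : B, (prodP p n θ x * (p θ y * Real.log (p θ y))
        - prodP p n θ x * p θ y * Real.log (AA p n w x y)
        + prodP p n θ x * p θ y * Real.log (BB p n w x)) ∂w) =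
      ∑ y, (∫ θ, prodP p n θ x * (p θ y * Real.log (p θ y)) ∂w)
        - ∑ y, AA p n w x y * Real.log (AA p n w x y) + BB p n w x * Real.log (BB p n w x) := by
    intro x
    rw [integral_finsetSum _ fun y _ => i4 x y]
    nth_rewrite 2 [← sum_AA hp hmeas n w x]
    rw [Finset.sum_mul, ← Finset.sum_sub_distrib, ← Finset.sum_add_distrib]
    refine Finset.sum_congr rfl fun y _ => ?_
    have i5 : Integrable (fun θ => prodP p n θ x * (p θ y * Real.log (p θ y))
        - prodP p n θ x * p θ y * Real.log (AA p n w x y)) w := (i1 x y).sub (i2 x y)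
    rw [integral_add i5 (i3 x y), integral_sub (i1 x y) (i2 x y),
      integral_mul_const, integral_mul_const]
    rfl
  rw [Finset.sum_congr rfl fun x _ => this x, Finset.sum_add_distrib, Finset.sum_sub_distrib]
  congr 2
  unfold hh
  rw [integral_finsetSum _ fun x _ => integrable_finsetSum _ fun y _ => i1 x y]
  refine Finset.sum_congr rfl fun x _ => ?_
  rw [integral_finsetSum _ fun y _ => i1 x y]

lemma integral_mix (w : Measure Θ) (θt : Θ) {t : ℝ} (ht : t ∈ Set.Icc (0:ℝ) 1)
    {f : Θ → ℝ} (hf : Measurable f) (hi : Integrable f w) :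
    ∫ θ, f θ ∂(mixPrior w θt t) = (1 - t) * (∫ θ, f θ ∂w) + t * f θt := by
  have hd : Integrable f (Measure.dirac θt) :=
    integrable_dirac' hf.stronglyMeasurable (by simp)
  unfold mixPrior
  rw [integral_add_measure (hi.smul_measure (by simp)) (hd.smul_measure (by simp)),
    integral_smul_measure, integral_smul_measure, integral_dirac' _ _ hf.stronglyMeasurable,
    ENNReal.toReal_ofReal (by linarith [ht.2]), ENNReal.toReal_ofReal ht.1]
  simp

lemma mix_prob (w : Measure Θ) [IsProbabilityMeasure w] (θt : Θ) {t : ℝ}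
    (ht : t ∈ Set.Icc (0:ℝ) 1) : IsProbabilityMeasure (mixPrior w θt t) := by
  constructor
  simp only [mixPrior, Measure.coe_add, Measure.coe_smul, Pi.add_apply, Pi.smul_apply,
    measure_univ, smul_eq_mul, mul_one]
  rw [← ENNReal.ofReal_add (by linarith [ht.2]) ht.1]
  simp

/-- singular coefficient -/
noncomputable def kk (u v : ℝ) : ℝ := if u = 0 then v else 0

/-- regular part of `φ((1-t)u+tv)`, with `φ(s) = s log s` -/
noncomputable def DD (u v t : ℝ) : ℝ :=
  if u = 0 then t * (v * Real.log v)
  else ((1 - t) * u + t * v) * Real.log ((1 - t) * u + t * v)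

/-- derivative of the regular part -/
noncomputable def dd (u v : ℝ) : ℝ :=
  if u = 0 then v * Real.log v else (v - u) * (Real.log u + 1)

lemma phi_eq (u v t : ℝ) :
    ((1 - t) * u + t * v) * Real.log ((1 - t) * u + t * v)
      = DD u v t + kk u v * (t * Real.log t) := by
  unfold DD kk
  split_ifs with h
  · subst h
    by_cases ht : t = 0
    · simp [ht]
    by_cases hv : v = 0
    · simp [hv]
    simp only [mul_zero, zero_add]
    rw [Real.log_mul ht hv]; ring
  · ring

lemma DD_deriv (u v : ℝ) : HasDerivAt (DD u v) (dd u v) 0 := by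
  unfold DD dd
  split_ifs with h
  · simpa using (hasDerivAt_id (0:ℝ)).mul_const (v * Real.log v)
  · have h1 : HasDerivAt (fun t : ℝ => (1 - t) * u + t * v) (v - u) 0 := by
      have := (((hasDerivAt_id (0:ℝ)).const_sub 1).mul_const u).add
        ((hasDerivAt_id (0:ℝ)).mul_const v)
      exact this.congr_deriv (by ring)
    have h2 : HasDerivAt (fun s : ℝ => s * Real.log s) (Real.log u + 1)
        ((1 - 0) * u + 0 * v) := by
      have e : (1 - 0) * u + 0 * v = u := by ring
      rw [e]
      exact Real.hasDerivAt_mul_log h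
    have := h2.comp (0:ℝ) h1
    exact this.congr_deriv (by ring)

/-- If `f t = D t - K t log t` has its maximum over `[0,1]` at `0` and `D` is differentiable
at `0`, then `K ≤ 0`. -/
lemma K_nonpos {D : ℝ → ℝ} {d K : ℝ} (hD : HasDerivAt D d 0)
    (hmax : ∀ t ∈ Set.Icc (0:ℝ) 1, D t - K * (t * Real.log t) ≤ D 0) : K ≤ 0 := by
  by_contra! hK
  have h1 : Tendsto (fun t : ℝ => t⁻¹ * (D t - D 0)) (nhdsWithin 0 (Set.Ioi 0)) (nhds d) := by
    have := (hasDerivAt_iff_tendsto_slope.1 hD).mono_left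
      (nhdsWithin_mono 0 (fun t (ht : 0 < t) => ht.ne'))
    refine this.congr fun t => ?_
    simp [slope_def_field, div_eq_inv_mul]
  have h2 : Tendsto (fun t : ℝ => K * Real.log t) (nhdsWithin 0 (Set.Ioi 0)) atBot :=
    Real.tendsto_log_nhdsGT_zero.const_mul_atBot hK
  have e1 := h1.eventually (eventually_gt_nhds (show d - 1 < d by linarith))
  have e2 := h2.eventually (eventually_lt_atBot (d - 1))
  have e3 : ∀ᶠ t in nhdsWithin (0:ℝ) (Set.Ioi 0), t ∈ Set.Ioc (0:ℝ) 1 := 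
    Ioc_mem_nhdsGT one_pos
  obtain ⟨t, a1, a2, a3⟩ := (e1.and (e2.and e3)).exists
  have := hmax t ⟨a3.1.le, a3.2⟩
  have h4 : t⁻¹ * (D t - D 0) ≤ K * Real.log t := by
    rw [inv_mul_le_iff₀ a3.1]; linarith
  linarith

end CMRD

open CMRD in
/-- If `w*` attains `C = sup_w I_w(θ;Y|X^n)` and `w_t = (1-t)w* + tδ_θ̃` for
`t ∈ [0,1]`, then `f(t) = I_{w_t}(θ;Y|X^n)` has right derivative at `t = 0` equal to
`R(p̂*,θ̃) - C`, where `p̂*` is the conditional mixture predictor of `w*`. -/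
theorem capacity_mixture_right_derivative
    {𝒳 Θ : Type*} [Fintype 𝒳] [Nonempty 𝒳] [MeasurableSpace Θ]
    (ℓ n : ℕ) (hℓ : 0 < ℓ) (hn : 0 < n)
    (p : Θ → (Fin ℓ → 𝒳) → ℝ)
    (hp : ∀ θ, IsPMF (p θ))
    (hmeas : ∀ z : Fin ℓ → 𝒳, Measurable fun θ => p θ z)
    (wstar : Measure Θ) [IsProbabilityMeasure wstar]
    (hopt : ∀ w : Measure Θ, IsProbabilityMeasure w →
      condMI p n w ≤ condMI p n wstar)
    (θt : Θ) :
    HasDerivWithinAt (fun t : ℝ => condMI p n (mixPrior wstar θt t))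
      (batchRegret p n (mixPred p n wstar) θt - condMI p n wstar)
      (Set.Icc 0 1) 0 := by
  have hA : ∀ t ∈ Set.Icc (0:ℝ) 1, ∀ x y, AA p n (mixPrior wstar θt t) x y =
      (1 - t) * AA p n wstar x y + t * (prodP p n θt x * p θt y) := fun t ht x y =>
    integral_mix wstar θt ht ((P_meas hmeas n x).mul (hmeas y)) (int_Pp hp hmeas n wstar x y)
  have hB : ∀ t ∈ Set.Icc (0:ℝ) 1, ∀ x, BB p n (mixPrior wstar θt t) x =
      (1 - t) * BB p n wstar x + t * prodP p n θt x := fun t ht x =>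
    integral_mix wstar θt ht (P_meas hmeas n x) (int_P hp hmeas n wstar x)
  have hsA := fun x => sum_AA hp hmeas n wstar x
  have hA0 := fun x y => AA_nonneg hp n wstar x y
  have hC := condMI_eq hp hmeas n wstar
  have hf : ∀ t ∈ Set.Icc (0:ℝ) 1, condMI p n (mixPrior wstar θt t) =
      ((1 - t) * (∫ θ, hh p n θ ∂wstar) + t * hh p n θt)
      - ∑ x, ∑ y, ((1 - t) * AA p n wstar x y + t * (prodP p n θt x * p θt y)) *
          Real.log ((1 - t) * AA p n wstar x y + t * (prodP p n θt x * p θt y))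
      + ∑ x, ((1 - t) * BB p n wstar x + t * prodP p n θt x) *
          Real.log ((1 - t) * BB p n wstar x + t * prodP p n θt x) := by
    intro t ht
    haveI := mix_prob wstar θt ht
    rw [condMI_eq hp hmeas n (mixPrior wstar θt t),
      integral_mix wstar θt ht (hh_meas hmeas n) (hh_int hp hmeas n wstar)]
    simp only [hA t ht, hB t ht]
  generalize hAe : AA p n wstar = A at *
  generalize hBe : BB p n wstar = b at *
  generalize hhe : (∫ θ, hh p n θ ∂wstar) = h0 at *
  have hP := fun x => P_nonneg hp n θt x
  have hp0 := (hp θt).1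
  have hp1 := (hp θt).2
  set K : ℝ := ∑ x, (∑ y, kk (A x y) (prodP p n θt x * p θt y) - kk (b x) (prodP p n θt x))
    with hKdef
  set D : ℝ → ℝ := fun t => ((1 - t) * h0 + t * hh p n θt)
      - ∑ x, ∑ y, DD (A x y) (prodP p n θt x * p θt y) t
      + ∑ x, DD (b x) (prodP p n θt x) t with hDdef
  have hfD : ∀ t ∈ Set.Icc (0:ℝ) 1, condMI p n (mixPrior wstar θt t) =
      D t - K * (t * Real.log t) := by
    intro t ht
    rw [hf t ht]
    simp only [phi_eq]
    simp only [hDdef, hKdef, Finset.sum_add_distrib, Finset.sum_sub_distrib, sub_mul,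
      Finset.sum_mul]
    ring
  have hD : HasDerivAt D ((hh p n θt - h0)
      - ∑ x, ∑ y, dd (A x y) (prodP p n θt x * p θt y)
      + ∑ x, dd (b x) (prodP p n θt x)) 0 := by
    have h1 : HasDerivAt (fun t : ℝ => (1 - t) * h0 + t * hh p n θt) (hh p n θt - h0) 0 := by
      have := (((hasDerivAt_id (0:ℝ)).const_sub 1).mul_const h0).add
        ((hasDerivAt_id (0:ℝ)).mul_const (hh p n θt))
      exact this.congr_deriv (by ring)
    exact (h1.sub (HasDerivAt.fun_sum fun x _ => HasDerivAt.fun_sum fun y _ => DD_deriv _ _)).add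
      (HasDerivAt.fun_sum fun x _ => DD_deriv _ _)
  have hm0 : mixPrior wstar θt 0 = wstar := by simp [mixPrior]
  have hbA : ∀ x, b x = 0 → ∀ y, A x y = 0 := by
    intro x h y
    rw [← hsA x] at h
    exact (Finset.sum_eq_zero_iff_of_nonneg (fun i _ => hA0 x i)).1 h y (Finset.mem_univ _)
  have hkA : ∀ x y, 0 ≤ kk (A x y) (prodP p n θt x * p θt y) := by
    intro x y; unfold kk; split_ifs
    · exact mul_nonneg (hP x) (hp0 y)
    · exact le_rfl
  have hterm : ∀ x, 0 ≤ ∑ y, kk (A x y) (prodP p n θt x * p θt y)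
      - kk (b x) (prodP p n θt x) := by
    intro x
    by_cases h : b x = 0
    · simp [kk, h, hbA x h, ← Finset.mul_sum, hp1]
    · have : kk (b x) (prodP p n θt x) = 0 := by simp [kk, h]
      rw [this, sub_zero]
      exact Finset.sum_nonneg fun y _ => hkA x y
  have hz : (0:ℝ) ∈ Set.Icc (0:ℝ) 1 := by simp
  have hK0 : K = 0 := by
    refine le_antisymm (K_nonpos hD fun t ht => ?_) (Finset.sum_nonneg fun x _ => hterm x)
    have e0 := hfD 0 hz
    rw [hm0] at e0
    simp only [zero_mul, mul_zero, sub_zero] at e0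
    rw [← hfD t ht, ← e0]
    exact hopt _ (mix_prob wstar θt ht)
  have hzero : ∀ x, b x ≠ 0 → ∀ y, A x y = 0 → prodP p n θt x * p θt y = 0 := by
    intro x hx y hy
    have h1 := (Finset.sum_eq_zero_iff_of_nonneg (fun x _ => hterm x)).1 hK0 x (Finset.mem_univ _)
    have h2 : kk (b x) (prodP p n θt x) = 0 := by simp [kk, hx]
    rw [h2, sub_zero] at h1
    have h3 := (Finset.sum_eq_zero_iff_of_nonneg (fun y _ => hkA x y)).1 h1 y (Finset.mem_univ _)
    simpa [kk, hy] using h3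
  have hval : batchRegret p n (mixPred p n wstar) θt - condMI p n wstar = (hh p n θt - h0)
      - ∑ x, ∑ y, dd (A x y) (prodP p n θt x * p θt y)
      + ∑ x, dd (b x) (prodP p n θt x) := by
    have hx : ∀ x, prodP p n θt x * ∑ y, p θt y * Real.log (p θt y / (A x y / b x)) =
        ∑ y, prodP p n θt x * (p θt y * Real.log (p θt y))
        - ∑ y, dd (A x y) (prodP p n θt x * p θt y) + dd (b x) (prodP p n θt x)
        - ∑ y, A x y * Real.log (A x y) + b x * Real.log (b x) := by
      intro x
      by_cases h : b x = 0
      · simp only [dd, h, hbA x h, if_true, div_zero, Real.log_zero, mul_zero, zero_mul,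
          Finset.sum_const_zero, sub_zero, add_zero]
        have e : ∀ y, prodP p n θt x * p θt y * Real.log (prodP p n θt x * p θt y) =
            prodP p n θt x * (p θt y * Real.log (p θt y))
            + p θt y * (prodP p n θt x * Real.log (prodP p n θt x)) := by
          intro y
          by_cases h1 : prodP p n θt x = 0
          · simp [h1]
          by_cases h2 : p θt y = 0
          · simp [h2]
          rw [Real.log_mul h1 h2]; ring
        simp only [e, Finset.sum_add_distrib, ← Finset.sum_mul, hp1]
        ring
      · have e : ∀ y, prodP p n θt x * (p θt y * Real.log (p θt y / (A x y / b x))) =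
            prodP p n θt x * (p θt y * Real.log (p θt y))
            - dd (A x y) (prodP p n θt x * p θt y)
            + (prodP p n θt x * p θt y - A x y) * (Real.log (b x) + 1)
            - A x y * Real.log (A x y) + A x y * Real.log (b x) := by
          intro y
          by_cases h1 : A x y = 0
          · have h2 := hzero x h y h1
            rw [← mul_assoc, ← mul_assoc, h2]; simp [h1, dd]
          · by_cases h2 : p θt y = 0
            · simp [h2, dd, h1]; ring
            · rw [Real.log_div h2 (div_ne_zero h1 h), Real.log_div h1 h]
              simp only [dd, h1, if_false]; ring
        rw [Finset.mul_sum, Finset.sum_congr rfl fun y _ => e y]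
        simp only [Finset.sum_add_distrib, Finset.sum_sub_distrib, ← Finset.sum_mul, hsA,
          ← Finset.mul_sum, hp1, mul_one]
        simp only [dd, h, if_false]

    have hR : batchRegret p n (mixPred p n wstar) θt =
        ∑ x, prodP p n θt x * ∑ y, p θt y * Real.log (p θt y / (A x y / b x)) := by
      rw [← hAe, ← hBe]; rfl
    rw [hR, hC, Finset.sum_congr rfl fun x _ => hx x]
    simp only [Finset.sum_add_distrib, Finset.sum_sub_distrib, hh]
    ring
  rw [hval]
  refine hD.hasDerivWithinAt.congr (fun t ht => ?_) ?_
  · rw [hfD t ht, hK0]; ring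
  · rw [hfD 0 hz, hK0]; ring
end

section
/- (Lower bound on the batch regret for binary i.i.d. sources.) There exists a constant K > 0 such that for all positive integers n and ℓ with nℓ ≥ 2, the minimax batch regret for the class of Bernoulli product sources satisfies: min over batch predictors p̂ of max_{θ∈[0,1]} R(p̂,θ) ≥ (1/2)·log(1 + 1/n) − K·log(nℓ)/(nℓ). -/
open MeasureTheory Real Filter

/-- The Bernoulli(θ) product probability of a binary string:
`p_θ(z) = θ^k (1-θ)^(m-k)`, where `k` is the number of ones in `z`. -/
def bern (m : ℕ) (θ : ℝ) (z : Fin m → Bool) : ℝ :=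
  ∏ i, if z i then θ else 1 - θ


noncomputable def Sm (m : ℕ) : ℝ := ∑ k ∈ Finset.range (m+1), Real.log (m.choose k)

lemma Sm_succ (m : ℕ) : Sm (m+1) = Sm m + ((m+1:ℝ) * Real.log (m+1) - Real.log ((m+1).factorial)) := by
  unfold Sm
  rw [Finset.sum_range_succ]
  have h1 : ∀ k ∈ Finset.range (m+1), Real.log ((m+1).choose k) = Real.log (m.choose k) + (Real.log (m+1) - Real.log ((m - k : ℕ) + 1 : ℝ)) := by
    intro k hk
    have hk' : k ≤ m := by simpa [Nat.lt_succ_iff] using hk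
    have h := Nat.choose_mul_succ_eq m k
    have h3 : m + 1 - k = (m - k) + 1 := by omega
    rw [h3] at h
    have h4 : ((m.choose k : ℝ)) * (m+1) = ((m+1).choose k) * ((m-k:ℕ)+1) := by exact_mod_cast h
    have p1 : (0:ℝ) < m.choose k := by exact_mod_cast Nat.choose_pos hk'
    have p2 : (0:ℝ) < (m+1).choose k := by exact_mod_cast Nat.choose_pos (by omega)
    have h5 := congrArg Real.log h4
    rw [Real.log_mul (by positivity) (by positivity), Real.log_mul (by positivity) (by positivity)] at h5
    linarith
  rw [Finset.sum_congr rfl h1, Finset.sum_add_distrib, Finset.sum_sub_distrib]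
  have h6 : ∑ k ∈ Finset.range (m+1), Real.log ((m - k : ℕ) + 1 : ℝ) = Real.log ((m+1).factorial) := by
    have := Finset.sum_range_reflect (fun k => Real.log ((k:ℝ)+1)) (m+1)
    simp only [Nat.add_sub_cancel] at this
    rw [this, ← Finset.prod_range_add_one_eq_factorial]
    push_cast
    rw [Real.log_prod]
    intros; positivity
  rw [h6]; simp

noncomputable def dm (m : ℕ) : ℝ := (m:ℝ) * Real.log m - Real.log (m.factorial)

lemma dm_succ (m : ℕ) : dm (m+1) - dm m = (m:ℝ) * (Real.log (m+1) - Real.log m) := by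
  unfold dm
  rw [Nat.factorial_succ]
  have : (0:ℝ) < m.factorial := by exact_mod_cast Nat.factorial_pos m
  push_cast
  rw [Real.log_mul (by positivity) (by positivity)]
  ring

lemma log_diff_lower (m : ℕ) (hm : 0 < m) : 2 / (2*(m:ℝ)+1) ≤ Real.log (m+1) - Real.log m := by
  have p : (0:ℝ) < m := by exact_mod_cast hm
  rw [← Real.log_div (by positivity) (by positivity)]
  have := Real.le_log_one_add_of_nonneg (x := 1/(m:ℝ)) (by positivity)
  have e1 : ((m:ℝ)+1)/m = 1 + 1/m := by field_simp
  rw [e1]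
  refine le_trans (le_of_eq ?_) this
  field_simp
  ring

lemma log_diff_upper (m : ℕ) (hm : 0 < m) : Real.log (m+1) - Real.log m ≤ 1/m := by
  have p : (0:ℝ) < m := by exact_mod_cast hm
  rw [← Real.log_div (by positivity) (by positivity)]
  have := Real.log_le_sub_one_of_pos (x := ((m:ℝ)+1)/m) (by positivity)
  have e1 : ((m:ℝ)+1)/m - 1 = 1/m := by field_simp; ring
  linarith

lemma log_diff_lower' (m : ℕ) (hm : 0 < m) : 1 / ((m:ℝ)+1) ≤ Real.log (m+1) - Real.log m := by
  have p : (0:ℝ) < m := by exact_mod_cast hm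
  refine le_trans ?_ (log_diff_lower m hm)
  rw [div_le_div_iff₀ (by positivity) (by positivity)]
  linarith

noncomputable def Tm (m : ℕ) : ℝ := (m+1:ℝ) * dm (m+1) - Sm m

lemma Tm_lower (m : ℕ) (hm : 0 < m) :
    (m:ℝ)^2/2 + m - (1 + Real.log m)/2 ≤ Tm m := by
  induction m, hm using Nat.le_induction with
  | base =>
    have h : Tm 1 = 2 * Real.log 2 := by
      simp [Tm, dm, Sm, Finset.sum_range_succ]; ring
    have := Real.log_two_gt_d9
    rw [h]; norm_num; linarith
  | succ m hm ih =>
    have hm : 0 < m := hm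
    have p : (0:ℝ) < m := by exact_mod_cast hm
    have hT : Tm (m+1) = Tm m + ((m:ℝ)+2)*((m:ℝ)+1)*(Real.log (m+2) - Real.log (m+1)) := by
      have h1 := dm_succ (m+1)
      have h2 := Sm_succ m
      have h3 : Sm (m+1) = Sm m + dm (m+1) := by rw [h2]; simp [dm]
      unfold Tm
      push_cast at *
      rw [h3, show (m:ℝ)+2 = m+1+1 by ring]
      linear_combination (m+1+1:ℝ) * h1
    have h4 := log_diff_lower (m+1) (by omega)
    have h5 := log_diff_lower' m hm
    push_cast at h4 ⊢
    rw [show (m:ℝ)+1+1 = m+2 by ring] at h4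
    have h6 : ((m:ℝ)+2)*((m:ℝ)+1)*(2/(2*((m:ℝ)+1)+1)) ≤ ((m:ℝ)+2)*((m:ℝ)+1)*(Real.log (m+2) - Real.log (m+1)) := by
      gcongr
    have h7 : (m:ℝ) + 1 + 1/2 - 1/(2*(m+1)) ≤ ((m:ℝ)+2)*((m:ℝ)+1)*(2/(2*((m:ℝ)+1)+1)) := by
      rw [← sub_nonneg]
      have : ((m:ℝ)+2)*((m:ℝ)+1)*(2/(2*((m:ℝ)+1)+1)) - ((m:ℝ) + 1 + 1/2 - 1/(2*(m+1))) = (m+2)/(2*(m+1)*(2*m+3)) := by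
        field_simp
        ring
      rw [this]; positivity
    have h8 : 1/(2*((m:ℝ)+1)) = 1/((m:ℝ)+1)/2 := by field_simp
    rw [hT]
    nlinarith

noncomputable def Fm (m : ℕ) : ℝ := Real.log (m+1) + Sm m / (m+1)

lemma Fm_step (m : ℕ) (hm : 0 < m) :
    1/2 + 1/2 * (Real.log (m+1) - Real.log m) - (2 + Real.log m/2) / (m*(m+1)) ≤ Fm (m+1) - Fm m := by
  have p : (0:ℝ) < m := by exact_mod_cast hm
  have hl : 0 ≤ Real.log m := Real.log_natCast_nonneg m
  have h3 : Sm (m+1) = Sm m + dm (m+1) := by rw [Sm_succ]; simp [dm]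
  have hF : Fm (m+1) - Fm m = (Real.log (m+2) - Real.log (m+1)) + Tm m / ((m+1)*(m+2)) := by
    unfold Fm Tm
    rw [h3]; push_cast
    rw [show (m:ℝ)+1+1 = m+2 by ring]
    field_simp
    ring
  have h4 := log_diff_lower' (m+1) (by omega)
  push_cast at h4
  rw [show (m:ℝ)+1+1 = m+2 by ring] at h4
  have h5 := log_diff_upper m hm
  have h6 : ((m:ℝ)^2/2 + m - (1 + Real.log m)/2) / ((m+1)*(m+2)) ≤ Tm m / ((m+1)*(m+2)) := by
    gcongr; exact Tm_lower m hm
  have h7 : 1/2 + 1/2 * (1/(m:ℝ)) - (2 + Real.log m/2) / (m*(m+1)) ≤ 1/(m+2) + ((m:ℝ)^2/2 + m - (1 + Real.log m)/2) / ((m+1)*(m+2)) := by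
    rw [← sub_nonneg]
    have : 1/((m:ℝ)+2) + ((m:ℝ)^2/2 + m - (1 + Real.log m)/2) / ((m+1)*(m+2)) - (1/2 + 1/2 * (1/(m:ℝ)) - (2 + Real.log m/2) / (m*(m+1)))
      = (3 + Real.log m) / (m*(m+1)*(m+2)) := by
      field_simp
      ring
    rw [this]; positivity
  linarith

noncomputable def gm (m : ℕ) : ℝ := (5/2 + Real.log m / 2) / m

lemma gm_step (m : ℕ) (hm : 0 < m) : (2 + Real.log m/2) / (m*(m+1)) ≤ gm m - gm (m+1) := by
  have p : (0:ℝ) < m := by exact_mod_cast hm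
  have h5 := log_diff_upper m hm
  unfold gm
  push_cast
  have : (5/2 + Real.log m / 2) / m - (5/2 + Real.log (m+1) / 2) / (m+1) - (2 + Real.log m/2) / (m*(m+1))
     = (1/m - (Real.log (m+1) - Real.log m)) / (2*((m:ℝ)+1)) := by
    field_simp; ring
  have : 0 ≤ (1/m - (Real.log (m+1) - Real.log m)) / (2*((m:ℝ)+1)) := div_nonneg (by linarith) (by positivity)
  linarith

lemma Fm_diff (N l : ℕ) (hN : 0 < N) :
    (l:ℝ)/2 + 1/2 * (Real.log (N+l) - Real.log N) - (gm N - gm (N+l)) ≤ Fm (N+l) - Fm N := by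
  induction l with
  | zero => simp
  | succ l ih =>
    have h1 := Fm_step (N+l) (by omega)
    have h2 := gm_step (N+l) (by omega)
    rw [show N + (l+1) = N + l + 1 by ring]
    push_cast at *
    rw [show (N:ℝ) + (l+1) = N + l + 1 by ring]
    linarith

lemma Fm_final (n l : ℕ) (hn : 0 < n) (hl : 0 < l) (h2 : 2 ≤ n*l) :
    (1/2) * Real.log (1 + 1/(n:ℝ)) - 10 * Real.log ((n:ℝ) * (l:ℝ)) / ((n:ℝ) * (l:ℝ)) ≤ Fm (n*l+l) - Fm (n*l) - l/2 := by
  have h := Fm_diff (n*l) l (by omega)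
  have pn : (0:ℝ) < n := by exact_mod_cast hn
  have pl : (0:ℝ) < l := by exact_mod_cast hl
  have hg : 0 ≤ gm (n*l+l) := by
    have := Real.log_natCast_nonneg (n*l+l)
    unfold gm; positivity
  have hg2 : gm (n*l) ≤ 10 * Real.log ((n:ℝ) * (l:ℝ)) / ((n:ℝ) * (l:ℝ)) := by
    unfold gm
    push_cast
    gcongr
    have : Real.log 2 ≤ Real.log ((n:ℝ)*l) := Real.log_le_log (by norm_num) (by exact_mod_cast h2)
    have := Real.log_two_gt_d9
    linarith
  have e : Real.log (1 + 1/(n:ℝ)) = Real.log ((n*l:ℕ)+l) - Real.log ((n*l:ℕ):ℝ) := by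
    push_cast
    rw [← Real.log_div (by positivity) (by positivity)]
    congr 1; field_simp
  rw [e]; linarith

lemma beta_int (b : ℕ) : ∀ a : ℕ, ∫ θ in (0:ℝ)..1, θ^a * (1-θ)^b = (a.factorial * b.factorial : ℝ) / (a+b+1).factorial := by
  induction b with
  | zero =>
    intro a
    simp [Nat.factorial_succ]
    have : (a.factorial : ℝ) ≠ 0 := by exact_mod_cast Nat.factorial_ne_zero a
    field_simp
  | succ b ih =>
    intro a
    have h : ∀ θ : ℝ, θ^a * (1-θ)^(b+1) = θ^a*(1-θ)^b - θ^(a+1)*(1-θ)^b := by intro θ; ring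
    simp_rw [h]
    rw [intervalIntegral.integral_sub (Continuous.intervalIntegrable (by fun_prop) _ _) (Continuous.intervalIntegrable (by fun_prop) _ _), ih, ih]
    rw [show a + 1 + b + 1 = (a+b+1)+1 by ring, show a + (b+1) + 1 = (a+b+1)+1 by ring]
    rw [Nat.factorial_succ (a+b+1), Nat.factorial_succ a, Nat.factorial_succ b]
    have : ((a+b+1).factorial : ℝ) ≠ 0 := by exact_mod_cast Nat.factorial_ne_zero _
    push_cast
    field_simp
    ring

lemma beta_int' (m k : ℕ) (hk : k ≤ m) : ∫ θ in (0:ℝ)..1, θ^k * (1-θ)^(m-k) = 1 / ((m+1) * m.choose k : ℝ) := by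
  rw [beta_int]
  have h := Nat.choose_mul_factorial_mul_factorial hk
  rw [show k + (m-k) + 1 = m+1 by omega, Nat.factorial_succ]
  have h' : (m.choose k : ℝ) * k.factorial * (m-k).factorial = m.factorial := by exact_mod_cast h
  have : (m.factorial : ℝ) ≠ 0 := by exact_mod_cast Nat.factorial_ne_zero _
  have : (m.choose k : ℝ) ≠ 0 := by exact_mod_cast (Nat.choose_pos hk).ne'
  push_cast
  rw [div_eq_div_iff (by positivity) (by positivity), ← h']
  ring

lemma int_negMulLog : ∫ θ in (0:ℝ)..1, Real.negMulLog θ = 1/4 := by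
  have hc : ContinuousOn (fun x : ℝ => x/2 * Real.negMulLog x + x^2/4) (Set.Icc 0 1) := by
    have := Real.continuous_negMulLog
    fun_prop
  have hd : ∀ x ∈ Set.Ioo (0:ℝ) 1, HasDerivAt (fun x : ℝ => x/2 * Real.negMulLog x + x^2/4) (Real.negMulLog x) x := by
    intro x hx
    have h1 := Real.hasDerivAt_negMulLog hx.1.ne'
    have h2 := (((hasDerivAt_id x).div_const 2).mul h1).add (((hasDerivAt_id x).pow 2).div_const 4)
    refine h2.congr_deriv ?_
    simp [Real.negMulLog]
    ring
  rw [intervalIntegral.integral_eq_sub_of_hasDerivAt_of_le zero_le_one hc hd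
    (Real.continuous_negMulLog.intervalIntegrable _ _)]
  norm_num [Real.negMulLog]

lemma int_h : ∫ θ in (0:ℝ)..1, (Real.negMulLog θ + Real.negMulLog (1-θ)) = 1/2 := by
  have := Real.continuous_negMulLog
  rw [intervalIntegral.integral_add (Continuous.intervalIntegrable (by fun_prop) _ _) (Continuous.intervalIntegrable (by fun_prop) _ _),
    intervalIntegral.integral_comp_sub_left (fun x => Real.negMulLog x) 1]
  norm_num [int_negMulLog]

/-- Bernoulli product on a general index type. -/
def pI {ι : Type*} [Fintype ι] (θ : ℝ) (z : ι → Bool) : ℝ := ∏ i, if z i then θ else 1 - θ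

/-- number of ones -/
def onesI {ι : Type*} [Fintype ι] (z : ι → Bool) : ℕ := (Finset.univ.filter (fun i => z i = true)).card

lemma onesI_le {ι : Type*} [Fintype ι] (z : ι → Bool) : onesI z ≤ Fintype.card ι := Finset.card_le_univ _

lemma pI_eq {ι : Type*} [Fintype ι] (θ : ℝ) (z : ι → Bool) :
    pI θ z = θ^(onesI z) * (1-θ)^(Fintype.card ι - onesI z) := by
  unfold pI onesI
  rw [Finset.prod_ite, Finset.prod_const, Finset.prod_const]
  congr 2
  have := Finset.card_filter_add_card_filter_not (s := (Finset.univ : Finset ι)) (fun i => z i = true)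
  rw [Finset.card_univ] at this
  omega

lemma sum_onesI {ι : Type*} [Fintype ι] [DecidableEq ι] (f : ℕ → ℝ) :
    ∑ z : ι → Bool, f (onesI z) = ∑ k ∈ Finset.range (Fintype.card ι + 1), ((Fintype.card ι).choose k : ℝ) * f k := by

  have h := Finset.sum_powerset_apply_card f (x := (Finset.univ : Finset ι))
  simp only [Finset.card_univ, nsmul_eq_mul] at h
  rw [← h]
  refine Finset.sum_bij' (fun z _ => Finset.univ.filter (fun i => z i = true)) (fun s _ i => decide (i ∈ s)) ?_ ?_ ?_ ?_ ?_
  · intros; simp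
  · intros; simp
  · intros; ext; simp
  · intros; ext; simp
  · intros; rfl

lemma pI_sum {ι : Type*} [Fintype ι] [DecidableEq ι] (θ : ℝ) : ∑ z : ι → Bool, pI θ z = 1 := by
  simp_rw [pI_eq]
  rw [sum_onesI (ι := ι) (fun k => θ^k * (1-θ)^(Fintype.card ι - k))]
  have := add_pow θ (1-θ) (Fintype.card ι)
  rw [add_sub_cancel, one_pow] at this
  refine Eq.trans ?_ this.symm
  refine Finset.sum_congr rfl fun k _ => by ring

lemma pI_cont {ι : Type*} [Fintype ι] (z : ι → Bool) : Continuous (fun θ => pI θ z) := by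
  simp_rw [pI_eq]; fun_prop

/-- marginal under the uniform prior -/
noncomputable def qI {ι : Type*} [Fintype ι] (z : ι → Bool) : ℝ := ∫ θ in (0:ℝ)..1, pI θ z

lemma qI_eq {ι : Type*} [Fintype ι] (z : ι → Bool) :
    qI z = 1 / ((Fintype.card ι + 1) * (Fintype.card ι).choose (onesI z) : ℝ) := by
  unfold qI
  simp_rw [pI_eq]
  exact beta_int' _ _ (onesI_le z)

lemma qI_pos {ι : Type*} [Fintype ι] (z : ι → Bool) : 0 < qI z := by
  rw [qI_eq]
  have : (0:ℝ) < (Fintype.card ι).choose (onesI z) := by exact_mod_cast Nat.choose_pos (onesI_le z)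
  positivity

lemma qI_ent {ι : Type*} [Fintype ι] [DecidableEq ι] : ∑ z : ι → Bool, Real.negMulLog (qI z) = Fm (Fintype.card ι) := by
  simp_rw [qI_eq]
  rw [sum_onesI (ι := ι) (fun k => Real.negMulLog (1 / ((Fintype.card ι + 1) * (Fintype.card ι).choose k : ℝ)))]
  generalize Fintype.card ι = m
  have h : ∀ k ∈ Finset.range (m+1), (m.choose k : ℝ) * Real.negMulLog (1 / ((m + 1) * m.choose k : ℝ))
      = Real.log (m+1) / (m+1) + Real.log (m.choose k) / (m+1) := by
    intro k hk
    have hk' : k ≤ m := by simpa [Nat.lt_succ_iff] using hk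
    have p1 : (0:ℝ) < m.choose k := by exact_mod_cast Nat.choose_pos hk'
    rw [Real.negMulLog, one_div, Real.log_inv, Real.log_mul (by positivity) (by positivity)]
    field_simp
  rw [Finset.sum_congr rfl h, Finset.sum_add_distrib, ← Finset.sum_div, ← Finset.sum_div]
  simp [Fm, Sm]
  field_simp

lemma qI_sum {ι : Type*} [Fintype ι] [DecidableEq ι] : ∑ z : ι → Bool, qI z = 1 := by
  unfold qI
  rw [← intervalIntegral.integral_finsetSum (fun z _ => (pI_cont z).intervalIntegrable _ _)]
  simp [pI_sum]

lemma bern_ent (l : ℕ) (θ : ℝ) : ∑ y : Fin l → Bool, Real.negMulLog (bern l θ y)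
    = l * (Real.negMulLog θ + Real.negMulLog (1-θ)) := by
  induction l with
  | zero => simp [bern]
  | succ l ih =>
    have hs : ∑ y : Fin l → Bool, bern l θ y = 1 := pI_sum θ
    rw [← (Fin.consEquiv (fun _ : Fin (l+1) => Bool)).sum_comp, Fintype.sum_prod_type]
    have hb : ∀ (b : Bool) (y : Fin l → Bool), bern (l+1) θ (Fin.cons b y) = (if b then θ else 1 - θ) * bern l θ y := by
      intro b y
      simp [bern, Fin.prod_univ_succ]
    change ∑ b : Bool, ∑ y : Fin l → Bool, Real.negMulLog (bern (l+1) θ (Fin.cons b y)) = _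
    simp only [hb, Real.negMulLog_mul, Finset.sum_add_distrib, ← Finset.sum_mul, ← Finset.mul_sum, hs, ih]
    simp
    ring

lemma regret_eq (n l : ℕ) (phat : (Fin n → Fin l → Bool) → (Fin l → Bool) → ℝ)
    (hp : ∀ x y, 0 < phat x y) (θ : ℝ) :
    batchRegret (fun θ : ℝ => bern l θ) n phat θ =
      - (l * (Real.negMulLog θ + Real.negMulLog (1-θ)))
      - ∑ x : Fin n → Fin l → Bool, ∑ y : Fin l → Bool, prodP (fun θ : ℝ => bern l θ) n θ x * bern l θ y * Real.log (phat x y) := by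
  have hx : ∑ x : Fin n → Fin l → Bool, prodP (fun θ : ℝ => bern l θ) n θ x = 1 := by
    unfold prodP
    rw [← Fintype.prod_sum (fun (_ : Fin n) (z : Fin l → Bool) => bern l θ z)]
    have hs : ∑ y : Fin l → Bool, bern l θ y = 1 := pI_sum θ
    simp [hs]
  unfold batchRegret
  have h1 : ∀ x : Fin n → Fin l → Bool, ∑ y : Fin l → Bool, bern l θ y * Real.log (bern l θ y / phat x y)
     = - (l * (Real.negMulLog θ + Real.negMulLog (1-θ))) - ∑ y : Fin l → Bool, bern l θ y * Real.log (phat x y) := by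
    intro x
    rw [← bern_ent, ← Finset.sum_neg_distrib, ← Finset.sum_sub_distrib]
    refine Finset.sum_congr rfl fun y _ => ?_
    by_cases h0 : bern l θ y = 0
    · simp [h0]
    · rw [Real.log_div h0 (hp x y).ne', Real.negMulLog]; ring
  simp_rw [h1, mul_sub, Finset.sum_sub_distrib, ← Finset.sum_mul, hx, Finset.mul_sum, one_mul, mul_assoc]

/-- The pair as one long string. -/
def joinXY {n l : ℕ} (x : Fin n → Fin l → Bool) (y : Fin l → Bool) : (Fin n × Fin l) ⊕ Fin l → Bool :=
  Sum.elim (Function.uncurry x) y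

lemma prodP_eq {n l : ℕ} (θ : ℝ) (x : Fin n → Fin l → Bool) :
    prodP (fun θ : ℝ => bern l θ) n θ x = pI θ (Function.uncurry x) := by
  unfold prodP bern pI
  rw [Fintype.prod_prod_type]
  rfl

lemma join_eq {n l : ℕ} (θ : ℝ) (x : Fin n → Fin l → Bool) (y : Fin l → Bool) :
    prodP (fun θ : ℝ => bern l θ) n θ x * bern l θ y = pI θ (joinXY x y) := by
  rw [prodP_eq]
  unfold bern pI joinXY
  rw [Fintype.prod_sum_type]
  rfl

lemma sum_join {n l : ℕ} (f : ((Fin n × Fin l) ⊕ Fin l → Bool) → ℝ) :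
    ∑ x : Fin n → Fin l → Bool, ∑ y : Fin l → Bool, f (joinXY x y) = ∑ z, f z := by
  rw [← Fintype.sum_prod_type', ← Equiv.sum_comp
    (((Equiv.curry (Fin n) (Fin l) Bool).symm.prodCongr (Equiv.refl (Fin l → Bool))).trans
      (Equiv.sumArrowEquivProdArrow (Fin n × Fin l) (Fin l) Bool).symm) f]
  rfl

lemma sum_uncurry {n l : ℕ} (f : (Fin n × Fin l → Bool) → ℝ) :
    ∑ x : Fin n → Fin l → Bool, f (Function.uncurry x) = ∑ z, f z := by
  rw [← Equiv.sum_comp (Equiv.curry (Fin n) (Fin l) Bool).symm f]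
  rfl

lemma marg_join {n l : ℕ} (x : Fin n → Fin l → Bool) :
    ∑ y : Fin l → Bool, qI (joinXY x y) = qI (Function.uncurry x) := by
  unfold qI
  rw [← intervalIntegral.integral_finsetSum (fun z _ => (pI_cont _).intervalIntegrable _ _)]
  congr 1
  ext θ
  simp_rw [← join_eq, ← prodP_eq]
  have hs : ∑ y : Fin l → Bool, bern l θ y = 1 := pI_sum θ
  rw [← Finset.mul_sum, hs, mul_one]

lemma gibbs_join {n l : ℕ} (phat : (Fin n → Fin l → Bool) → (Fin l → Bool) → ℝ)
    (hP : ∀ x, IsPMF (phat x)) (hp : ∀ x y, 0 < phat x y) :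
    ∑ x : Fin n → Fin l → Bool, ∑ y : Fin l → Bool, qI (joinXY x y) * Real.log (phat x y)
      ≤ Fm (n*l) - Fm (n*l+l) := by
  have h1 : ∀ (x : Fin n → Fin l → Bool) (y : Fin l → Bool), qI (joinXY x y) * Real.log (phat x y) ≤
      phat x y * qI (Function.uncurry x) - qI (joinXY x y) - Real.negMulLog (qI (joinXY x y))
       - qI (joinXY x y) * Real.log (qI (Function.uncurry x)) := by
    intro x y
    have a := hp x y
    have b := qI_pos (joinXY x y)
    have c := qI_pos (Function.uncurry x)
    have := Real.log_le_sub_one_of_pos (x := phat x y * qI (Function.uncurry x) / qI (joinXY x y)) (by positivity)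
    rw [Real.log_div (by positivity) (by positivity), Real.log_mul (by positivity) (by positivity)] at this
    have h := mul_le_mul_of_nonneg_left this b.le
    have e : qI (joinXY x y) * (phat x y * qI (Function.uncurry x) / qI (joinXY x y) - 1) = phat x y * qI (Function.uncurry x) - qI (joinXY x y) := by
      field_simp
    rw [e] at h
    rw [Real.negMulLog]
    linarith
  refine (Finset.sum_le_sum fun x _ => Finset.sum_le_sum fun y _ => h1 x y).trans (le_of_eq ?_)
  simp_rw [Finset.sum_sub_distrib, ← Finset.sum_mul, marg_join, (hP _).2, one_mul]
  rw [sum_join (fun z => Real.negMulLog (qI z)), sum_uncurry (fun z => qI z * Real.log (qI z)), qI_ent]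
  have h2 := qI_ent (ι := Fin n × Fin l)
  simp only [Real.negMulLog, neg_mul, Finset.sum_neg_distrib] at h2
  simp only [Fintype.card_prod, Fintype.card_fin, Fintype.card_sum] at h2 ⊢
  linarith

/-- **Lower bound on the batch regret for binary i.i.d. sources.**
There is a constant `K > 0` such that for all `n, ℓ ≥ 1` with `nℓ ≥ 2`, every (everywhere
positive) batch predictor `p̂` for the class of Bernoulli product sources satisfies
`max_{θ∈[0,1]} R(p̂,θ) ≥ (1/2) log(1 + 1/n) - K log(nℓ)/(nℓ)` (stated via upper bounds:
any `C` bounding `R(p̂,·)` on `[0,1]` is at least the right-hand side). -/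
theorem bernoulli_batch_regret_lower_bound :
    ∃ K : ℝ, 0 < K ∧
      ∀ n ℓ : ℕ, 0 < n → 0 < ℓ → 2 ≤ n * ℓ →
        ∀ phat : (Fin n → Fin ℓ → Bool) → (Fin ℓ → Bool) → ℝ,
          (∀ x, IsPMF (phat x)) → (∀ x y, 0 < phat x y) →
          ∀ C : ℝ,
            (∀ θ ∈ Set.Icc (0:ℝ) 1, batchRegret (fun θ : ℝ => bern ℓ θ) n phat θ ≤ C) →
            (1/2) * Real.log (1 + 1/(n:ℝ))
              - K * Real.log ((n:ℝ) * (ℓ:ℝ)) / ((n:ℝ) * (ℓ:ℝ)) ≤ C := by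
  refine ⟨10, by norm_num, ?_⟩
  intro n l hn hl h2 phat hP hp C hC
  refine (Fm_final n l hn hl h2).trans ?_
  have hg := gibbs_join phat hP hp
  have hcont := Real.continuous_negMulLog
  have hterm : ∀ x y, Continuous (fun θ : ℝ => pI θ (joinXY x y) * Real.log (phat x y)) :=
    fun x y => (pI_cont _).mul continuous_const
  have hs : Continuous (fun θ : ℝ => ∑ x : Fin n → Fin l → Bool, ∑ y : Fin l → Bool,
      pI θ (joinXY x y) * Real.log (phat x y)) :=
    continuous_finsetSum _ fun x _ => continuous_finsetSum _ fun y _ => hterm x y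
  have hh : Continuous (fun θ : ℝ => - ((l:ℝ) * (Real.negMulLog θ + Real.negMulLog (1-θ)))) := by fun_prop
  have hI : ∫ θ in (0:ℝ)..1, (- ((l:ℝ) * (Real.negMulLog θ + Real.negMulLog (1-θ)))
      - ∑ x : Fin n → Fin l → Bool, ∑ y : Fin l → Bool, pI θ (joinXY x y) * Real.log (phat x y)) ≤ ∫ θ in (0:ℝ)..1, C := by
    refine intervalIntegral.integral_mono_on zero_le_one ((hh.sub hs).intervalIntegrable _ _)
      (continuous_const.intervalIntegrable _ _) ?_
    intro θ hθ
    have := hC θ hθ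
    rw [regret_eq n l phat hp] at this
    simpa only [join_eq] using this
  rw [intervalIntegral.integral_sub (hh.intervalIntegrable _ _) (hs.intervalIntegrable _ _),
    intervalIntegral.integral_neg, intervalIntegral.integral_const_mul, int_h,
    intervalIntegral.integral_finsetSum (fun x _ =>
      (continuous_finsetSum _ fun y _ => hterm x y).intervalIntegrable _ _)] at hI
  have he : ∀ x, ∫ θ in (0:ℝ)..1, ∑ y : Fin l → Bool, pI θ (joinXY x y) * Real.log (phat x y)
      = ∑ y : Fin l → Bool, qI (joinXY x y) * Real.log (phat x y) := by
    intro x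
    rw [intervalIntegral.integral_finsetSum (fun y _ => (hterm x y).intervalIntegrable _ _)]
    simp [qI]
  simp_rw [he] at hI
  simp at hI
  linarith
end

section
/- Let w be the uniform (Lebesgue) prior on [0,1] and let p̂_w be the corresponding conditional mixture (Laplace add-one) predictor for the class of Bernoulli product sources, p̂_w(y|x^n) = ∫_0^1 p_θ(x^n)p_θ(y) dθ / ∫_0^1 p_θ(x^n) dθ. Then for all positive integers n, ℓ and every θ ∈ [1/(nℓ), 1 − 1/(nℓ)], the batch regret satisfies R(p̂_w,θ) ≥ (1/2)·log(1 + 1/n) − 5/(nℓ) − 5/(nℓ·θ(1−θ)). -/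
open MeasureTheory Real Filter

/-- The conditional mixture (Laplace add-one) predictor for the Bernoulli class under the
uniform prior on `[0,1]`:
`p̂_w(y|x^n) = (∫_0^1 p_θ(x^n) p_θ(y) dθ) / (∫_0^1 p_θ(x^n) dθ)`. -/
noncomputable def laplacePred (n ℓ : ℕ) (x : Fin n → Fin ℓ → Bool) (y : Fin ℓ → Bool) : ℝ :=
  (∫ θ in (0:ℝ)..1, prodP (fun θ : ℝ => bern ℓ θ) n θ x * bern ℓ θ y) /
    (∫ θ in (0:ℝ)..1, prodP (fun θ : ℝ => bern ℓ θ) n θ x)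

namespace LapAux

/-- Expectation of `f (ones) (zeros)` over `m` Bernoulli bits. -/
noncomputable def Em (θ : ℝ) : ℕ → (ℕ → ℕ → ℝ) → ℝ
  | 0, f => f 0 0
  | (m+1), f => Em θ m (fun a b => θ * f (a+1) b + (1-θ) * f a (b+1))

theorem Em_mono {θ : ℝ} (h0 : 0 ≤ θ) (h1 : 0 ≤ 1 - θ) (m : ℕ) :
    ∀ f g : ℕ → ℕ → ℝ, (∀ a b, a + b = m → f a b ≤ g a b) → Em θ m f ≤ Em θ m g := by
  induction m with
  | zero => intro f g h; exact h 0 0 rfl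
  | succ m ih =>
    intro f g h
    apply ih
    intro a b hab
    have h2 := h (a+1) b (by omega)
    have h3 := h a (b+1) (by omega)
    have := mul_le_mul_of_nonneg_left h2 h0
    have := mul_le_mul_of_nonneg_left h3 h1
    linarith

theorem Em_sub (θ : ℝ) (m : ℕ) :
    ∀ f g : ℕ → ℕ → ℝ, Em θ m (fun a b => f a b - g a b) = Em θ m f - Em θ m g := by
  induction m with
  | zero => intro f g; rfl
  | succ m ih =>
    intro f g
    simp only [Em]
    rw [← ih]
    congr 1
    funext a b
    ring

theorem Em_const (θ c : ℝ) (m : ℕ) : Em θ m (fun _ _ => c) = c := by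
  induction m with
  | zero => rfl
  | succ m ih =>
    simp only [Em]
    rw [show θ * c + (1-θ) * c = c by ring]
    exact ih

theorem Em_add (θ : ℝ) (m k : ℕ) : ∀ f : ℕ → ℕ → ℝ,
    Em θ (m + k) f = Em θ m (fun a b => Em θ k (fun a' b' => f (a + a') (b + b'))) := by
  induction k with
  | zero => intro f; simp [Em]
  | succ k ih =>
    intro f
    rw [← add_assoc]
    simp only [Em]
    rw [ih]
    rfl

theorem Em_poly (θ : ℝ) (m : ℕ) : ∀ α β γ δ : ℝ,
    Em θ m (fun a b => α + β * ((a:ℝ) * (1-θ) - b * θ) + γ * ((a:ℝ) * (1-θ) - b * θ)^2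
      + δ * ((a:ℝ) * (1-θ) - b * θ)^3)
    = α + γ * (m * (θ * (1-θ))) + δ * (m * (θ * (1-θ)) * (1 - 2*θ)) := by
  induction m with
  | zero => intro α β γ δ; simp [Em]
  | succ m ih =>
    intro α β γ δ
    simp only [Em]
    have := ih (α + γ * (θ * (1-θ)) + δ * (θ * (1-θ) * (1-2*θ))) (β + 3 * δ * (θ * (1-θ))) γ δ
    push_cast
    rw [show α + γ * ((m + 1) * (θ * (1-θ))) + δ * ((m + 1) * (θ * (1-θ)) * (1 - 2*θ))
      = (α + γ * (θ * (1-θ)) + δ * (θ * (1-θ) * (1-2*θ))) + γ * (m * (θ * (1-θ)))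
        + δ * (m * (θ * (1-θ)) * (1 - 2*θ)) by ring, ← this]
    congr 1
    funext a b
    ring

def ones {m : ℕ} (z : Fin m → Bool) : ℕ := ∑ i, if z i then 1 else 0
def zeros {m : ℕ} (z : Fin m → Bool) : ℕ := ∑ i, if z i then 0 else 1

theorem bern_eq (m : ℕ) (θ : ℝ) (z : Fin m → Bool) :
    bern m θ z = θ ^ ones z * (1-θ) ^ zeros z := by
  unfold bern ones zeros
  rw [← Finset.prod_pow_eq_pow_sum, ← Finset.prod_pow_eq_pow_sum, ← Finset.prod_mul_distrib]
  apply Finset.prod_congr rfl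
  intro i _
  cases z i <;> simp

theorem prodP_eq (n ℓ : ℕ) (θ : ℝ) (x : Fin n → Fin ℓ → Bool) :
    prodP (fun θ : ℝ => bern ℓ θ) n θ x
      = θ ^ (∑ i, ones (x i)) * (1-θ) ^ (∑ i, zeros (x i)) := by
  unfold prodP
  rw [← Finset.prod_pow_eq_pow_sum, ← Finset.prod_pow_eq_pow_sum, ← Finset.prod_mul_distrib]
  apply Finset.prod_congr rfl
  intro i _
  exact bern_eq _ _ _

theorem sum_bern (θ : ℝ) (m : ℕ) : ∀ f : ℕ → ℕ → ℝ,
    ∑ z : Fin m → Bool, bern m θ z * f (ones z) (zeros z) = Em θ m f := by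
  induction m with
  | zero => intro f; simp [Em, bern, ones, zeros]
  | succ m ih =>
    intro f
    simp only [Em]
    rw [← ih, ← (Fin.consEquiv (fun _ : Fin (m+1) => Bool)).sum_comp, Fintype.sum_prod_type,
      Finset.sum_comm]
    apply Finset.sum_congr rfl
    intro z _
    simp only [Fintype.sum_bool, Fin.consEquiv, Equiv.coe_fn_mk, bern, ones, zeros,
      Fin.prod_univ_succ, Fin.sum_univ_succ, Fin.cons_zero, Fin.cons_succ, if_true]
    simp only [Bool.false_eq_true, if_false, zero_add]
    rw [add_comm 1, add_comm 1]
    ring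

theorem sum_prodP (θ : ℝ) (ℓ n : ℕ) : ∀ f : ℕ → ℕ → ℝ,
    ∑ x : Fin n → Fin ℓ → Bool, prodP (fun θ : ℝ => bern ℓ θ) n θ x *
      f (∑ i, ones (x i)) (∑ i, zeros (x i)) = Em θ (n * ℓ) f := by
  induction n with
  | zero => intro f; simp [Em, prodP]
  | succ n ih =>
    intro f
    rw [Nat.succ_mul, Em_add, ← ih,
      ← (Fin.consEquiv (fun _ : Fin (n+1) => (Fin ℓ → Bool))).sum_comp, Fintype.sum_prod_type,
      Finset.sum_comm]
    apply Finset.sum_congr rfl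
    intro x _
    rw [← sum_bern, Finset.mul_sum]
    apply Finset.sum_congr rfl
    intro y _
    simp only [Fin.consEquiv, Equiv.coe_fn_mk, prodP,
      Fin.prod_univ_succ, Fin.sum_univ_succ, Fin.cons_zero, Fin.cons_succ]
    rw [add_comm (ones y), add_comm (zeros y)]
    ring

noncomputable def I (a b : ℕ) : ℝ := ∫ t in (0:ℝ)..1, t ^ a * (1-t) ^ b

theorem I_pos (a b : ℕ) : 0 < I a b := by
  unfold I
  apply intervalIntegral.intervalIntegral_pos_of_pos_on
  · exact Continuous.intervalIntegrable (by fun_prop) _ _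
  · intro x hx
    have h1 := hx.1
    have h2 : 0 < 1 - x := by linarith [hx.2]
    positivity
  · norm_num

theorem I_add (a b : ℕ) : I (a+1) b + I a (b+1) = I a b := by
  unfold I
  rw [← intervalIntegral.integral_add]
  · congr 1; funext t; ring
  · exact Continuous.intervalIntegrable (by fun_prop) _ _
  · exact Continuous.intervalIntegrable (by fun_prop) _ _

theorem I_parts (a b : ℕ) : (a+1) * I a (b+1) = (b+1) * I (a+1) b := by
  have key : ∫ t in (0:ℝ)..1, ((a+1) * (t ^ a * (1-t)^(b+1)) - (b+1) * (t^(a+1) * (1-t)^b))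
      = 1 ^ (a+1) * (1-1)^(b+1) - 0 ^ (a+1) * (1-0)^(b+1) := by
    apply intervalIntegral.integral_eq_sub_of_hasDerivAt (f := fun t : ℝ => t^(a+1) * (1-t)^(b+1))
    · intro t _
      have h1 := hasDerivAt_pow (a+1) t
      have h2 := ((hasDerivAt_id t).const_sub 1).pow (b+1)
      have h3 := h1.mul h2
      refine HasDerivAt.congr_deriv h3 ?_
      simp
      ring
    · exact Continuous.intervalIntegrable (by fun_prop) _ _
  rw [intervalIntegral.integral_sub, intervalIntegral.integral_const_mul,
    intervalIntegral.integral_const_mul] at key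
  · simp at key
    unfold I
    linarith
  · exact Continuous.intervalIntegrable (by fun_prop) _ _
  · exact Continuous.intervalIntegrable (by fun_prop) _ _

theorem I_succ_left (a b : ℕ) : I (a+1) b = I a b * ((a+1) / (a+b+2)) := by
  have h1 := I_add a b
  have h2 := I_parts a b
  have : (0:ℝ) < a + b + 2 := by positivity
  field_simp
  rw [← h1]
  linarith

theorem I_succ_right (a b : ℕ) : I a (b+1) = I a b * ((b+1) / (a+b+2)) := by
  have h1 := I_add a b
  have h2 := I_parts a b
  have : (0:ℝ) < a + b + 2 := by positivity
  field_simp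
  rw [← h1]
  linarith

noncomputable def H (θ : ℝ) (a b : ℕ) : ℝ := a * log θ + b * log (1-θ) - log (I a b)

theorem laplacePred_eq (n ℓ : ℕ) (x : Fin n → Fin ℓ → Bool) (y : Fin ℓ → Bool) :
    laplacePred n ℓ x y = I (∑ i, ones (x i) + ones y) (∑ i, zeros (x i) + zeros y)
      / I (∑ i, ones (x i)) (∑ i, zeros (x i)) := by
  unfold laplacePred I
  simp only [prodP_eq, bern_eq]
  congr 2
  funext t
  ring

theorem regret_eq (n ℓ : ℕ) {θ : ℝ} (h0 : 0 < θ) (h1 : 0 < 1 - θ) :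
    batchRegret (fun θ : ℝ => bern ℓ θ) n (laplacePred n ℓ) θ
      = Em θ (n * ℓ + ℓ) (H θ) - Em θ (n * ℓ) (H θ) := by
  rw [Em_add, ← Em_sub, ← sum_prodP]
  unfold batchRegret
  apply Finset.sum_congr rfl
  intro x _
  congr 1
  set A := ∑ i, ones (x i) with hA
  set B := ∑ i, zeros (x i) with hB
  rw [← Em_const θ (H θ A B) ℓ, ← Em_sub, ← sum_bern]
  apply Finset.sum_congr rfl
  intro y _
  congr 1
  beta_reduce
  rw [laplacePred_eq, bern_eq, ← hA, ← hB]
  have p1 := I_pos A B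
  have p2 := I_pos (A + ones y) (B + zeros y)
  rw [log_div (by positivity) (by positivity), log_div p2.ne' p1.ne',
    log_mul (by positivity) (by positivity), log_pow, log_pow]
  unfold H
  push_cast
  ring

theorem neg_log_ge {u : ℝ} (hu : -1 < u) : -u + u^2/2 - u^3/3 ≤ -log (1+u) := by
  let g : ℝ → ℝ := fun u => -log (1+u) + u - u^2/2 + u^3/3
  have hd : ∀ x : ℝ, -1 < x → HasDerivAt g (x^3/(1+x)) x := by
    intro x hx
    have hx' : 0 < 1 + x := by linarith
    have e1 := (((hasDerivAt_id x).const_add 1).log hx'.ne').neg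
    have e2 := ((e1.add (hasDerivAt_id x)).sub ((hasDerivAt_pow 2 x).div_const 2)).add
      ((hasDerivAt_pow 3 x).div_const 3)
    refine HasDerivAt.congr_deriv e2 ?_
    simp
    field_simp
    ring
  have g0 : g 0 = 0 := by simp [g]
  suffices h : g 0 ≤ g u by
    rw [g0] at h
    simp only [g] at h
    linarith
  rcases le_total 0 u with h | h
  · have hm : MonotoneOn g (Set.Ici 0) := by
      apply monotoneOn_of_deriv_nonneg (convex_Ici 0)
      · intro x hx
        have hx : (0:ℝ) ≤ x := hx
        exact (hd x (by linarith)).continuousAt.continuousWithinAt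
      · intro x hx
        rw [interior_Ici] at hx
        have hx : (0:ℝ) < x := hx
        exact (hd x (by linarith)).differentiableAt.differentiableWithinAt
      · intro x hx
        rw [interior_Ici] at hx
        have hx : (0:ℝ) < x := hx
        rw [(hd x (by linarith)).deriv]
        positivity
    exact hm (Set.mem_Ici.2 le_rfl) (Set.mem_Ici.2 h) h
  · have hm : AntitoneOn g (Set.Ioc (-1) 0) := by
      apply antitoneOn_of_deriv_nonpos (convex_Ioc _ 0)
      · intro x hx
        exact (hd x hx.1).continuousAt.continuousWithinAt
      · intro x hx
        rw [interior_Ioc] at hx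
        exact (hd x hx.1).differentiableAt.differentiableWithinAt
      · intro x hx
        rw [interior_Ioc] at hx
        rw [(hd x hx.1).deriv]
        have h1 : 0 < 1 + x := by linarith [hx.1]
        apply div_nonpos_of_nonpos_of_nonneg _ h1.le
        have := hx.2
        nlinarith [sq_nonneg x]
    exact hm ⟨hu, h⟩ ⟨by norm_num, le_rfl⟩ h

/-- Lower bound on the binary divergence. -/
theorem kl_ge {θ q : ℝ} (h0 : 0 < θ) (h1 : 0 < 1 - θ) (q0 : 0 < q) (q1 : 0 < 1 - q) :
    (q-θ)^2 / (2 * (θ * (1-θ))) - (q-θ)^3 * (1-2*θ) / (3 * (θ * (1-θ))^2)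
    ≤ θ * (log θ - log q) + (1-θ) * (log (1-θ) - log (1-q)) := by
  have a1 := neg_log_ge (u := (q-θ)/θ) (by rw [lt_div_iff₀ h0]; linarith)
  have a2 := neg_log_ge (u := (θ-q)/(1-θ)) (by rw [lt_div_iff₀ h1]; linarith)
  rw [show 1 + (q-θ)/θ = q/θ by field_simp; ring, log_div q0.ne' h0.ne'] at a1
  rw [show 1 + (θ-q)/(1-θ) = (1-q)/(1-θ) by field_simp; ring, log_div q1.ne' h1.ne'] at a2
  have b1 := mul_le_mul_of_nonneg_left a1 h0.le
  have b2 := mul_le_mul_of_nonneg_left a2 h1.le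
  refine le_trans (le_of_eq ?_) ((add_le_add b1 b2).trans (le_of_eq (by ring)))
  field_simp
  ring

theorem step {θ : ℝ} (h0 : 0 < θ) (h1 : 0 < 1 - θ) (m : ℕ) :
    ((m:ℝ) * (θ*(1-θ)) + (1-2*θ)^2) / (2 * (θ*(1-θ)) * (m+2)^2)
      - (1-2*θ) * (4 * m * (θ*(1-θ)) * (1-2*θ) + (1-2*θ)^3) / (3 * (θ*(1-θ))^2 * (m+2)^3)
    ≤ Em θ (m+1) (H θ) - Em θ m (H θ) := by
  simp only [Em]
  rw [← Em_sub]
  have hM : (0:ℝ) < m + 2 := by positivity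
  set v := θ * (1-θ) with hv
  have hvp : 0 < v := mul_pos h0 h1
  set c := 1 - 2*θ with hc
  set γ : ℝ := 1 / (2 * v * (m+2)^2) with hγ
  set δ : ℝ := - c / (3 * v^2 * (m+2)^3) with hδ
  have hp := Em_poly θ m (γ * c^2 + δ * c^3) (2 * γ * c + 3 * δ * c^2) (γ + 3 * δ * c) δ
  rw [← hv, ← hc] at hp
  have e : ((m:ℝ) * v + c^2) / (2 * v * (m+2)^2)
      - c * (4 * m * v * c + c^3) / (3 * v^2 * (m+2)^3)
      = γ * c ^ 2 + δ * c ^ 3 + (γ + 3 * δ * c) * (↑m * v) + δ * (↑m * v * c) := by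
    rw [hγ, hδ]
    field_simp
    ring
  rw [e, ← hp]
  apply Em_mono h0.le h1.le
  intro a b hab
  have hab' : (m:ℝ) = a + b := by rw [← hab]; push_cast; ring
  have hk := kl_ge (q := (a+1)/(a+b+2)) h0 h1 (by positivity) (by
    rw [show (1:ℝ) - (a+1)/(a+b+2) = (b+1)/(a+b+2) by field_simp; ring]; positivity)
  rw [show (1:ℝ) - (a+1)/(a+b+2) = (b+1)/(a+b+2) by field_simp; ring, ← hv, ← hc] at hk
  have hR : θ * H θ (a + 1) b + (1 - θ) * H θ a (b + 1) - H θ a b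
      = θ * (log θ - log (((a:ℝ)+1)/(a+b+2))) + (1-θ) * (log (1-θ) - log (((b:ℝ)+1)/(a+b+2))) := by
    have p := I_pos a b
    unfold H
    rw [I_succ_left, I_succ_right, log_mul p.ne' (by positivity), log_mul p.ne' (by positivity)]
    push_cast
    ring
  rw [hR]
  refine le_trans (le_of_eq ?_) hk
  have hd : ((a:ℝ)+1)/(a+b+2) - θ = ((a:ℝ) * (1-θ) - b * θ + c) / (m+2) := by
    rw [hab', hc]
    field_simp
    ring
  rw [hd, hγ, hδ]
  generalize (a:ℝ) * (1-θ) - b * θ = S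
  field_simp
  ring

theorem step_num {v c m : ℝ} (hv : 0 < v) (hm : 2 ≤ m) (hmv : 1/2 ≤ m * v) (hc : c^2 ≤ 1) :
    1/2 * (1/m) - 5 * (1 + 1/v) * (1/(m*(m+1)))
    ≤ (m * v + c^2) / (2 * v * (m+2)^2)
      - c * (4 * m * v * c + c^3) / (3 * v^2 * (m+2)^3) := by
  have hm0 : 0 < m := by linarith
  have t1 : 1/2*(1/m) - 3 * (1/(m*(m+1))) ≤ m * v / (2 * v * (m+2)^2) := by
    rw [show m * v / (2 * v * (m+2)^2) = m / (2 * (m+2)^2) by field_simp,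
      show 1/2*(1/m) - 3 * (1/(m*(m+1))) = (m - 5) / (2 * (m * (m+1))) by field_simp; ring,
      div_le_div_iff₀ (by positivity) (by positivity)]
    nlinarith [mul_pos hm0 hm0]
  have t2 : 0 ≤ c^2 / (2 * v * (m+2)^2) := by positivity
  have t3 : c * (4 * m * v * c + c^3) / (3 * v^2 * (m+2)^3) ≤ 5 * (1/v * (1/(m*(m+1)))) := by
    rw [show 5 * (1/v * (1/(m*(m+1)))) = 5 / (v * (m * (m+1))) by field_simp,
      show c * (4 * m * v * c + c^3) = c^2 * (4 * m * v + c^2) by ring]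
    have : c^2 * (4 * m * v + c^2) ≤ 1 * (4 * m * v + 2 * (m * v)) := by
      apply mul_le_mul hc _ (by positivity) (by norm_num)
      linarith
    calc _ ≤ (6 * m * v) / (3 * v^2 * (m+2)^3) := by
          apply div_le_div_of_nonneg_right _ (by positivity)
          linarith
      _ = 2 * m / (v * (m+2)^3) := by field_simp; norm_num
      _ ≤ _ := by
        rw [div_le_div_iff₀ (by positivity) (by positivity)]
        have : 2 * m * (m * (m+1)) ≤ 5 * (m+2)^3 := by nlinarith [mul_pos hm0 hm0, mul_pos (mul_pos hm0 hm0) hm0]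
        nlinarith
  have t4 : 0 < 1/(m*(m+1)) := by positivity
  rw [add_div]
  have : 5 * (1 + 1/v) * (1/(m*(m+1))) = 5 * (1/(m*(m+1))) + 5 * (1/v * (1/(m*(m+1)))) := by ring
  linarith

end LapAux

open LapAux

/-- For the Bernoulli class with the uniform prior `w` on `[0,1]`, the batch
regret of the conditional mixture predictor `p̂_w` satisfies, for every
`θ ∈ [1/(nℓ), 1 - 1/(nℓ)]`,
`R(p̂_w,θ) ≥ (1/2) log(1 + 1/n) - 5/(nℓ) - 5/(nℓ θ(1-θ))`. -/
theorem laplace_predictor_regret_lower_bound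
    (n ℓ : ℕ) (hn : 0 < n) (hℓ : 0 < ℓ) :
    ∀ θ : ℝ, θ ∈ Set.Icc (1 / ((n:ℝ) * (ℓ:ℝ))) (1 - 1 / ((n:ℝ) * (ℓ:ℝ))) →
      (1/2) * Real.log (1 + 1/(n:ℝ)) - 5 / ((n:ℝ) * (ℓ:ℝ))
          - 5 / ((n:ℝ) * (ℓ:ℝ)) * (1 / (θ * (1 - θ)))
        ≤ batchRegret (fun θ : ℝ => bern ℓ θ) n (laplacePred n ℓ) θ := by
  intro θ hθ
  obtain ⟨hl, hu⟩ := hθ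
  have hn' : (0:ℝ) < n := by exact_mod_cast hn
  have hℓ' : (0:ℝ) < ℓ := by exact_mod_cast hℓ
  set N : ℝ := (n:ℝ) * ℓ with hN
  have hN0 : 0 < N := by positivity
  have hi : 0 < 1 / N := by positivity
  have h0 : 0 < θ := by linarith
  have h1 : 0 < 1 - θ := by linarith
  have hN2 : 2 ≤ N := by
    have : 1 / N ≤ 1/2 := by linarith
    rw [div_le_div_iff₀ hN0 (by norm_num)] at this
    linarith
  have hNi : N * (1/N) = 1 := by field_simp
  have a1 : 1 ≤ N * θ := by nlinarith
  have a2 : 1 ≤ N * (1-θ) := by nlinarith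
  have hNv : 1/2 ≤ N * (θ * (1-θ)) := by
    rcases le_total θ (1/2) with h | h <;> nlinarith
  set v := θ * (1-θ) with hv
  have hv0 : 0 < v := mul_pos h0 h1
  have hc : (1 - 2*θ)^2 ≤ 1 := by nlinarith
  have main : ∀ k : ℕ, 1/2 * log ((N + k) / N) - 5 * (1 + 1/v) * (1/N - 1/(N+k))
      ≤ Em θ (n * ℓ + k) (H θ) - Em θ (n * ℓ) (H θ) := by
    intro k
    induction k with
    | zero => simp [hN0.ne']
    | succ k ih =>
      have hs := step h0 h1 (n * ℓ + k)
      have hk : (0:ℝ) ≤ k := by positivity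
      have hm0 : 0 < N + k := by linarith
      have hnum := step_num (v := v) (c := 1 - 2*θ) (m := N + k) hv0 (by linarith)
        (by nlinarith) hc
      have hcast : ((n * ℓ + k : ℕ) : ℝ) = N + k := by rw [hN]; push_cast; ring
      rw [hcast, ← hv] at hs
      have hlog : log ((N + (k+1)) / N) ≤ log ((N+k)/N) + 1/(N+k) := by
        have : (N + (k+1)) / N = ((N+k)/N) * (1 + 1/(N+k)) := by field_simp; ring
        rw [this, log_mul (by positivity) (by positivity)]
        have := log_le_sub_one_of_pos (x := 1 + 1/(N+k)) (by positivity)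
        linarith
      have htel : 1/N - 1/(N+(k+1)) = (1/N - 1/(N+k)) + 1/((N+k)*(N+k+1)) := by
        field_simp
        ring
      push_cast
      rw [htel, ← add_assoc, ← add_assoc, mul_add (5 * (1+1/v))]
      rw [← add_assoc] at hlog
      linarith
  rw [regret_eq n ℓ h0 h1]
  refine le_trans ?_ (main ℓ)
  have e : (N + ℓ)/N = 1 + 1/n := by rw [hN]; field_simp
  rw [e]
  have : 0 ≤ 5 * (1+1/v) * (1/(N+ℓ)) := by positivity
  have e2 : 5 * (1+1/v) * (1/N - 1/(N+ℓ)) = 5 / N + 5 / N * (1/v) - 5 * (1+1/v) * (1/(N+ℓ)) := by ring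
  rw [e2]
  linarith
end
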